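/- Let U ⊂ ℝ^{n+1} be open, p ∈ U, and let ν, μ : U → ℝ^{n+1} be C¹ vector fields with η(ν,ν) ≡ −1, η(μ,μ) ≡ 1 and η(μ,e) ≡ 0 on U. Define α := η(ν,μ), v := −η(ν,e), and at p set μ⊤ := μ + αν, ν^Σ := ν − αμ, e^τ := e − (v/(1+α²))ν^Σ. Assume at p: v > 0, D_e μ(p) = 0, Dν(p) is η-self-adjoint on ν(p)^⊥, Dμ(p) is η-self-adjoint on μ(p)^⊥, and D_{e^τ} v(p) = 0. Then at p, A(e^τ, e^τ) = α·A^Σ(e^τ, e^τ) + (vα/(1+α²))·D_{e^τ} α, where A(X,Y) := η(D_X ν, Y) and A^Σ(X,Y) := η(D_X μ, Y). -/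

import Mathlib

noncomputable section

/-- The Minkowski inner product `η` on `ℝ^{n+1}`:
`η(x,y) = ∑_{i=1}^n xᵢyᵢ - x_{n+1}y_{n+1}`. -/
def eta {n : ℕ} (x y : Fin (n + 1) → ℝ) : ℝ :=
  (∑ i : Fin n, x i.castSucc * y i.castSucc) - x (Fin.last n) * y (Fin.last n)

/-- The timelike coordinate vector `e := e_{n+1}`, with `η(e,e) = -1`. -/
def eVec (n : ℕ) : Fin (n + 1) → ℝ := Pi.single (Fin.last n) 1

theorem eta_comm {n : ℕ} (x y : Fin (n + 1) → ℝ) : eta x y = eta y x := by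
  simp only [eta, mul_comm]

/-- The Minkowski inner product as a continuous bilinear map. -/
def etaCLM (n : ℕ) : (Fin (n + 1) → ℝ) →L[ℝ] (Fin (n + 1) → ℝ) →L[ℝ] ℝ :=
  (LinearMap.mk₂ ℝ eta
    (fun x y z => by simp only [eta, Pi.add_apply, add_mul, Finset.sum_add_distrib]; ring)
    (fun c x y => by
      simp only [eta, Pi.smul_apply, smul_eq_mul, mul_assoc, ← Finset.mul_sum, mul_sub])
    (fun x y z => by simp only [eta, Pi.add_apply, mul_add, Finset.sum_add_distrib]; ring)
    (fun c x y => by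
      simp only [eta, Pi.smul_apply, smul_eq_mul, mul_left_comm _ c, ← Finset.mul_sum,
        mul_sub])).toContinuousBilinearMap

theorem etaCLM_apply {n : ℕ} (x y : Fin (n + 1) → ℝ) : etaCLM n x y = eta x y := rfl

/-- The product rule for the Minkowski inner product. -/
theorem fderiv_eta_apply {n : ℕ} {E : Type*} [NormedAddCommGroup E] [NormedSpace ℝ E]
    {f g : E → Fin (n + 1) → ℝ} {p : E}
    (hf : DifferentiableAt ℝ f p) (hg : DifferentiableAt ℝ g p) (X : E) :
    fderiv ℝ (fun x => eta (f x) (g x)) p X =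
      eta (f p) (fderiv ℝ g p X) + eta (fderiv ℝ f p X) (g p) :=
  congrArg (· X) ((etaCLM n).fderiv_of_bilinear hf hg)

/-- If `η(f, g)` is constant on an open set, its derivative vanishes there. -/
theorem eta_fderiv_add_eq_zero {n : ℕ} {E : Type*} [NormedAddCommGroup E] [NormedSpace ℝ E]
    {f g : E → Fin (n + 1) → ℝ} {U : Set E} (hU : IsOpen U) {p : E} (hp : p ∈ U) {c : ℝ}
    (h : ∀ x ∈ U, eta (f x) (g x) = c)
    (hf : DifferentiableAt ℝ f p) (hg : DifferentiableAt ℝ g p) (X : E) :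
    eta (f p) (fderiv ℝ g p X) + eta (fderiv ℝ f p X) (g p) = 0 := by
  have hc : (fun x => eta (f x) (g x)) =ᶠ[nhds p] fun _ => c :=
    Filter.eventually_of_mem (hU.mem_nhds hp) h
  rw [← fderiv_eta_apply hf hg, hc.fderiv_eq]
  simp

/-- **Equation `tanderiv`** (identity at a boundary critical point of the gradient
function): under the hypotheses of Lemma `bdryv`, with additionally `Dμ(p)`
`η`-self-adjoint on `μ(p)^⊥`, `v > 0`, and the critical point condition
`D_{e^τ} v(p) = 0`, one has
`A(e^τ,e^τ) = α A^Σ(e^τ,e^τ) + (vα/(1+α²)) D_{e^τ} α`. -/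
theorem tangential_identity_at_critical_point
    {n : ℕ} (U : Set (Fin (n + 1) → ℝ)) (hU : IsOpen U)
    (ν μ : (Fin (n + 1) → ℝ) → Fin (n + 1) → ℝ)
    (hν : ContDiffOn ℝ 1 ν U) (hμ : ContDiffOn ℝ 1 μ U)
    (hνunit : ∀ x ∈ U, eta (ν x) (ν x) = -1)
    (hμunit : ∀ x ∈ U, eta (μ x) (μ x) = 1)
    (hμe : ∀ x ∈ U, eta (μ x) (eVec n) = 0)
    (p : Fin (n + 1) → ℝ) (hp : p ∈ U)
    (α v : ℝ) (hα : α = eta (ν p) (μ p)) (hv : v = -eta (ν p) (eVec n))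
    (hvpos : 0 < v)
    (μtop νSig eτ : Fin (n + 1) → ℝ)
    (hμtop : μtop = μ p + α • ν p) (hνSig : νSig = ν p - α • μ p)
    (heτ : eτ = eVec n - (v / (1 + α ^ 2)) • νSig)
    -- the cylinder normal is extended vertically: `D_e μ(p) = 0`
    (hdeμ : fderiv ℝ μ p (eVec n) = 0)
    -- `Dν(p)` is `η`-self-adjoint on `ν(p)^⊥`
    (hsymν : ∀ X Y : Fin (n + 1) → ℝ, eta X (ν p) = 0 → eta Y (ν p) = 0 →
      eta (fderiv ℝ ν p X) Y = eta (fderiv ℝ ν p Y) X)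
    -- `Dμ(p)` is `η`-self-adjoint on `μ(p)^⊥`
    (hsymμ : ∀ X Y : Fin (n + 1) → ℝ, eta X (μ p) = 0 → eta Y (μ p) = 0 →
      eta (fderiv ℝ μ p X) Y = eta (fderiv ℝ μ p Y) X)
    -- critical point of the gradient function in the direction `e^τ`
    (hcrit : fderiv ℝ (fun x => -eta (ν x) (eVec n)) p eτ = 0) :
    eta (fderiv ℝ ν p eτ) eτ =
      α * eta (fderiv ℝ μ p eτ) eτ +
        (v * α / (1 + α ^ 2)) * fderiv ℝ (fun x => eta (ν x) (μ x)) p eτ := by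
  have hνp : DifferentiableAt ℝ ν p :=
    (hν.contDiffAt (hU.mem_nhds hp)).differentiableAt one_ne_zero
  have hμp : DifferentiableAt ℝ μ p :=
    (hμ.contDiffAt (hU.mem_nhds hp)).differentiableAt one_ne_zero
  have hνν := eta_fderiv_add_eq_zero hU hp hνunit hνp hνp eτ
  have hμμ := eta_fderiv_add_eq_zero hU hp hμunit hμp hμp eτ
  have hμe' := eta_fderiv_add_eq_zero hU hp hμe hμp (differentiableAt_const _) eτ
  rw [fderiv_fun_neg, neg_apply,
    fderiv_eta_apply hνp (differentiableAt_const _)] at hcrit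
  rw [fderiv_eta_apply hνp hμp]
  have expand : ∀ X, eta X eτ =
      eta X (eVec n) - v / (1 + α ^ 2) * (eta X (ν p) - α * eta X (μ p)) := by
    intro X
    simp only [heτ, hνSig, ← etaCLM_apply, map_sub, map_smul, smul_eq_mul]
  have eta_zero : eta (ν p) 0 = 0 ∧ eta (μ p) 0 = 0 := by simp [eta]
  simp only [fderiv_fun_const, Pi.zero_apply, zero_apply, eta_zero] at hμe' hcrit
  rw [eta_comm (ν p)] at hνν ⊢
  rw [eta_comm (μ p)] at hμμ
  rw [expand, expand]
  linear_combination -hcrit - v / (1 + α ^ 2) / 2 * hνν - α * hμe' -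
    α * (v / (1 + α ^ 2)) * α / 2 * hμμ
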